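/- Fix integers N ≥ 1, K ≥ 1, D ≥ 1, a data matrix X ∈ ℝ^{N×D}, a binary feature matrix Z ∈ {0,1}^{N×K} (empty features allowed) with feature sizes S_k = Σ_{n=1}^N Z_{nk}, a feature-means matrix A ∈ ℝ^{K×D}, and constants ρ² > 0 and λ² > 0. Let K⁺ = #{k : S_k ≥ 1} be the number of nonempty features. For σ² > 0 set γ(σ²) = exp(−λ²/(2σ²)) and define P(σ²) = (2πσ²)^{−ND/2} exp(−tr((X − ZA)ᵀ(X − ZA))/(2σ²)) · Π_{k=1}^K [Γ(S_k + γ(σ²)) Γ(N − S_k + 1) Γ(γ(σ²) + 1) / (Γ(N + γ(σ²) + 1) Γ(γ(σ²)))] · (2πρ²)^{−KD/2} exp(−tr(AᵀA)/(2ρ²)). Then −2σ² log P(σ²) converges to tr((X − ZA)ᵀ(X − ZA)) + K⁺ λ² as σ² → 0⁺. -/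

import Mathlib

open Matrix Filter Finset Real

/-- If `f` has a nonzero limit at `0⁺` then `s log f(s)` vanishes there. -/
lemma tendsto_neg_two_mul_log_zero {f : ℝ → ℝ} {c : ℝ} (hc : c ≠ 0)
    (hf : Tendsto f (nhdsWithin 0 (Set.Ioi 0)) (nhds c)) :
    Tendsto (fun s => -2 * s * Real.log (f s)) (nhdsWithin 0 (Set.Ioi 0)) (nhds 0) := by
  have hs : Tendsto (fun s : ℝ => -2 * s) (nhdsWithin 0 (Set.Ioi 0)) (nhds 0) :=
    tendsto_nhdsWithin_of_tendsto_nhds (Continuous.tendsto' (by fun_prop) _ _ (by simp))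
  simpa using hs.mul (hf.log hc)

lemma tendsto_exp_neg_div_zero {l : ℝ} (hl : 0 < l) :
    Tendsto (fun s : ℝ => Real.exp (-l / (2 * s))) (nhdsWithin 0 (Set.Ioi 0)) (nhds 0) := by
  refine Real.tendsto_exp_atBot.comp ?_
  have h : Tendsto (fun s : ℝ => (-l / 2) * s⁻¹) (nhdsWithin 0 (Set.Ioi 0)) atBot :=
    tendsto_inv_nhdsGT_zero.const_mul_atTop_of_neg (by linarith)
  refine h.congr fun s => ?_
  rw [div_mul_eq_div_div, div_eq_mul_inv (-l / 2) s]

lemma tendsto_Gamma_add {g : ℝ → ℝ} {F : Filter ℝ} (hg : Tendsto g F (nhds 0))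
    {a : ℝ} (ha : 0 < a) :
    Tendsto (fun s => Real.Gamma (a + g s)) F (nhds (Real.Gamma a)) := by
  have hcont : ContinuousAt Real.Gamma a :=
    (Real.differentiableAt_Gamma fun m => by
      have : (0 : ℝ) ≤ m := m.cast_nonneg
      linarith).continuousAt
  exact hcont.tendsto.comp (by simpa using hg.const_add a)

/-- The Beta-Bernoulli marginal of one feature of size `m` among `N` data points. -/
noncomputable def betaBernoulliFactor (N m : ℕ) (g : ℝ) : ℝ :=
  Real.Gamma (m + g) * Real.Gamma ((N : ℝ) - m + 1) * Real.Gamma (g + 1)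
    / (Real.Gamma ((N : ℝ) + g + 1) * Real.Gamma g)

lemma betaBernoulliFactor_pos {N m : ℕ} (hm : m ≤ N) {g : ℝ} (hg : 0 < g) :
    0 < betaBernoulliFactor N m g := by
  have h : (m : ℝ) ≤ N := by exact_mod_cast hm
  have h1 := Real.Gamma_pos_of_pos (s := (m : ℝ) + g) (by positivity)
  have h2 := Real.Gamma_pos_of_pos (s := (N : ℝ) - m + 1) (by linarith)
  have h3 := Real.Gamma_pos_of_pos (s := g + 1) (by positivity)
  have h4 := Real.Gamma_pos_of_pos (s := (N : ℝ) + g + 1) (by positivity)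
  have h5 := Real.Gamma_pos_of_pos hg
  unfold betaBernoulliFactor
  positivity

lemma tendsto_neg_two_mul_log_betaBernoulliFactor {N m : ℕ} (hm : m ≤ N) {l : ℝ} (hl : 0 < l) :
    Tendsto (fun s => -2 * s * Real.log (betaBernoulliFactor N m (Real.exp (-l / (2 * s)))))
      (nhdsWithin 0 (Set.Ioi 0)) (nhds (if 1 ≤ m then l else 0)) := by
  have hg := tendsto_exp_neg_div_zero hl
  have hmN : (m : ℝ) ≤ N := by exact_mod_cast hm
  have hΓN : 0 < Real.Gamma ((N : ℝ) + 1) := Real.Gamma_pos_of_pos (by positivity)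
  have hΓNm : 0 < Real.Gamma ((N : ℝ) - m + 1) := Real.Gamma_pos_of_pos (by linarith)
  have hden := tendsto_Gamma_add hg (a := (N : ℝ) + 1) (by positivity)
  split_ifs with h
  · have hm0 : (0 : ℝ) < m := by exact_mod_cast h
    have hlim := (((tendsto_Gamma_add hg hm0).mul_const (Real.Gamma ((N : ℝ) - m + 1))).div
      hden hΓN.ne')
    have hlog := tendsto_neg_two_mul_log_zero
      (div_pos (mul_pos (Real.Gamma_pos_of_pos hm0) hΓNm) hΓN).ne' hlim
    have := hlog.const_add l
    rw [add_zero] at this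
    refine this.congr' ?_
    filter_upwards [self_mem_nhdsWithin] with s hs
    have hs : 0 < s := hs
    set g := Real.exp (-l / (2 * s)) with hgdef
    have hg0 : 0 < g := Real.exp_pos _
    have h1 := Real.Gamma_pos_of_pos (s := (m : ℝ) + g) (by positivity)
    have h4 := Real.Gamma_pos_of_pos (s := (N : ℝ) + 1 + g) (by positivity)
    have h5 := Real.Gamma_pos_of_pos hg0
    have hF : betaBernoulliFactor N m g = g *
        (Real.Gamma (m + g) * Real.Gamma ((N : ℝ) - m + 1) / Real.Gamma ((N : ℝ) + 1 + g)) := by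
      rw [betaBernoulliFactor, Real.Gamma_add_one hg0.ne', add_right_comm (N : ℝ) g 1]
      field_simp
    rw [hF, Real.log_mul hg0.ne' (by positivity), hgdef, Real.log_exp, ← hgdef, mul_add]
    simp only [Pi.div_apply]
    congr 1
    field_simp
  · obtain rfl : m = 0 := by omega
    have hlim := ((tendsto_Gamma_add hg one_pos).const_mul (Real.Gamma ((N : ℝ) + 1))).div
      hden hΓN.ne'
    refine (tendsto_neg_two_mul_log_zero (by simp [hΓN.ne']) hlim).congr fun s => ?_
    have h5 := Real.Gamma_pos_of_pos (Real.exp_pos (-l / (2 * s)))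
    congr 2
    simp only [Pi.div_apply, betaBernoulliFactor, Nat.cast_zero, zero_add, sub_zero]
    rw [add_right_comm (N : ℝ) _ 1, add_comm 1 (Real.exp _)]
    field_simp

lemma tendsto_neg_two_mul_log_gaussian (a T : ℝ) :
    Tendsto (fun s => -2 * s * Real.log ((2 * Real.pi * s) ^ a * Real.exp (-T / (2 * s))))
      (nhdsWithin 0 (Set.Ioi 0)) (nhds T) := by
  have h1 := tendsto_neg_two_mul_log_zero (f := fun _ => 2 * Real.pi) (by positivity)
    tendsto_const_nhds
  have h2 := (Real.continuous_mul_log.tendsto' 0 0 (by simp)).mono_left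
    (nhdsWithin_le_nhds (s := Set.Ioi 0)) |>.const_mul (-2 : ℝ)
  have h := ((h1.add h2).const_mul a).add_const T
  simp only [mul_zero, add_zero, zero_add] at h
  refine h.congr' ?_
  filter_upwards [self_mem_nhdsWithin] with s hs
  have hs : 0 < s := hs
  have hpow : (2 * Real.pi * s) ^ a ≠ 0 := by positivity
  rw [Real.log_mul hpow (Real.exp_ne_zero _), Real.log_rpow (by positivity),
    Real.log_mul (by positivity) hs.ne', Real.log_exp]
  field_simp
  ring

/-- Small-variance asymptotics for the Beta-Bernoulli linear-Gaussian feature model with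
scaled `γ(σ²) = exp(−λ²/(2σ²))`: `-2σ² log P(σ²)` converges to the K-features objective
plus a penalty of `λ²` per nonempty feature. -/
theorem penalized_k_features_objective_limit
    (N K D : ℕ) (hN : 1 ≤ N) (hK : 1 ≤ K) (hD : 1 ≤ D)
    (X : Matrix (Fin N) (Fin D) ℝ)
    (Z : Matrix (Fin N) (Fin K) ℝ)
    (hZbin : ∀ n k, Z n k = 0 ∨ Z n k = 1)
    (S : Fin K → ℕ) (hS : ∀ k, (S k : ℝ) = ∑ n, Z n k)
    (Kplus : ℕ) (hKplus : Kplus = (univ.filter (fun k => 1 ≤ S k)).card)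
    (A : Matrix (Fin K) (Fin D) ℝ)
    (ρ2 lam2 : ℝ) (hρ2 : 0 < ρ2) (hlam2 : 0 < lam2)
    (γ : ℝ → ℝ) (hγ : ∀ s, γ s = Real.exp (-lam2 / (2 * s)))
    (P : ℝ → ℝ)
    (hP : ∀ s, 0 < s → P s =
      ((2 * Real.pi * s) ^ (-((N : ℝ) * D) / 2)
        * Real.exp (- Matrix.trace ((X - Z * A)ᵀ * (X - Z * A)) / (2 * s)))
      * (∏ k, (Real.Gamma (S k + γ s) * Real.Gamma ((N : ℝ) - S k + 1)
          * Real.Gamma (γ s + 1)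
          / (Real.Gamma ((N : ℝ) + γ s + 1) * Real.Gamma (γ s))))
      * ((2 * Real.pi * ρ2) ^ (-((K : ℝ) * D) / 2)
          * Real.exp (- Matrix.trace (Aᵀ * A) / (2 * ρ2)))) :
    Tendsto (fun s => -2 * s * Real.log (P s)) (nhdsWithin 0 (Set.Ioi 0))
      (nhds (Matrix.trace ((X - Z * A)ᵀ * (X - Z * A)) + (Kplus : ℝ) * lam2)) := by
  have hSN : ∀ k, S k ≤ N := fun k => by
    have h : (S k : ℝ) ≤ N := by
      rw [hS]
      calc ∑ n, Z n k ≤ ∑ _n : Fin N, (1 : ℝ) :=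
            sum_le_sum fun n _ => by rcases hZbin n k with h | h <;> simp [h]
        _ = N := by simp
    exact_mod_cast h
  obtain rfl : γ = fun s => Real.exp (-lam2 / (2 * s)) := funext hγ
  have hpri : (2 * Real.pi * ρ2) ^ (-((K : ℝ) * D) / 2)
      * Real.exp (- Matrix.trace (Aᵀ * A) / (2 * ρ2)) ≠ 0 := by positivity
  have hlik := tendsto_neg_two_mul_log_gaussian (-((N : ℝ) * D) / 2)
    (Matrix.trace ((X - Z * A)ᵀ * (X - Z * A)))
  have hprod := tendsto_finsetSum univ fun k _ =>
    tendsto_neg_two_mul_log_betaBernoulliFactor (hSN k) hlam2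
  have h := (hlik.add hprod).add (tendsto_neg_two_mul_log_zero hpri tendsto_const_nhds)
  rw [← sum_filter, sum_const, nsmul_eq_mul, ← hKplus, add_zero] at h
  refine h.congr' ?_
  filter_upwards [self_mem_nhdsWithin] with s hs
  have hs : 0 < s := hs
  have hfac : ∀ k ∈ univ, betaBernoulliFactor N (S k) (Real.exp (-lam2 / (2 * s))) ≠ 0 :=
    fun k _ => (betaBernoulliFactor_pos (hSN k) (Real.exp_pos _)).ne'
  have hlik0 : (2 * Real.pi * s) ^ (-((N : ℝ) * D) / 2)
      * Real.exp (- Matrix.trace ((X - Z * A)ᵀ * (X - Z * A)) / (2 * s)) ≠ 0 := by positivity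
  have hPs : P s = ((2 * Real.pi * s) ^ (-((N : ℝ) * D) / 2)
      * Real.exp (- Matrix.trace ((X - Z * A)ᵀ * (X - Z * A)) / (2 * s)))
      * (∏ k, betaBernoulliFactor N (S k) (Real.exp (-lam2 / (2 * s))))
      * ((2 * Real.pi * ρ2) ^ (-((K : ℝ) * D) / 2)
        * Real.exp (- Matrix.trace (Aᵀ * A) / (2 * ρ2))) := hP s hs
  rw [hPs, Real.log_mul (mul_ne_zero hlik0 (prod_ne_zero_iff.mpr hfac)) hpri,
    Real.log_mul hlik0 (prod_ne_zero_iff.mpr hfac), Real.log_prod hfac, ← mul_sum, mul_add,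
    mul_add]
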